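/- Let Q be a generalized Nevanlinna function with one negative square, and let z₁, z₂ ∈ ℂ⁺ be points at which Q is holomorphic. If Q(z₁) = Q(z₂) and this common value is real, then z₁ = z₂. In other words, Q attains each real value at most once in the open upper half-plane. -/

import Mathlib

open Complex MeasureTheory Filter Set

noncomputable def negEigCount {n : ℕ} (A : Matrix (Fin n) (Fin n) ℂ) : ℕ :=
  if h : A.IsHermitian then (Finset.univ.filter (fun i => h.eigenvalues i < 0)).card else 0

noncomputable def nevKernel (Q : ℂ → ℂ) {n : ℕ} (z : Fin n → ℂ) :
    Matrix (Fin n) (Fin n) ℂ :=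
  Matrix.of fun i j => (Q (z i) - (starRingEnd ℂ) (Q (z j))) / (z i - (starRingEnd ℂ) (z j))

/-- A generalized Nevanlinna function with one negative square: `Q` is holomorphic on a
domain `D ⊆ ℂ∖ℝ` whose complement in `ℂ∖ℝ` is discrete, is symmetric with respect to
conjugation, and the supremum over finite tuples of points of `D ∩ ℂ⁺` of the number of
negative eigenvalues of the Nevanlinna kernel matrix equals `1`. -/
structure IsGenNevanlinnaOne (Q : ℂ → ℂ) (D : Set ℂ) : Prop where
  subset : D ⊆ {z : ℂ | z.im ≠ 0}
  isOpen : IsOpen D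
  discrete_compl : DiscreteTopology ↥({z : ℂ | z.im ≠ 0} \ D)
  holo : DifferentiableOn ℂ Q D
  conj_mem : ∀ z ∈ D, (starRingEnd ℂ) z ∈ D
  symm : ∀ z ∈ D, Q ((starRingEnd ℂ) z) = (starRingEnd ℂ) (Q z)
  le_one : ∀ (n : ℕ) (z : Fin n → ℂ), (∀ i, z i ∈ D ∧ 0 < (z i).im) →
    negEigCount (nevKernel Q z) ≤ 1
  exists_one : ∃ (n : ℕ) (z : Fin n → ℂ), (∀ i, z i ∈ D ∧ 0 < (z i).im) ∧
    negEigCount (nevKernel Q z) = 1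

/-- A Nevanlinna function. -/
structure IsNevanlinna (M : ℂ → ℂ) : Prop where
  holo : DifferentiableOn ℂ M {z : ℂ | z.im ≠ 0}
  symm : ∀ z : ℂ, z.im ≠ 0 → M ((starRingEnd ℂ) z) = (starRingEnd ℂ) (M z)
  im_nonneg : ∀ z : ℂ, 0 < z.im → 0 ≤ (M z).im

theorem negEigCount_zero (n : ℕ) : negEigCount (0 : Matrix (Fin n) (Fin n) ℂ) = 0 := by
  have h : (0 : Matrix (Fin n) (Fin n) ℂ).IsHermitian := Matrix.isHermitian_zero
  rw [negEigCount, dif_pos h, Finset.card_eq_zero, Finset.filter_eq_empty_iff]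
  intro i _
  simp [h.eigenvalues_eq_zero_iff.mpr rfl]

open scoped ComplexOrder in
theorem posDef_of_negEigCount_le_one {n : ℕ} {A : Matrix (Fin n) (Fin n) ℂ}
    (hA : A.IsHermitian) (hdet : 0 < A.det.re) (hcount : negEigCount A ≤ 1) : A.PosDef := by
  have hprod : 0 < ∏ i, hA.eigenvalues i := by
    have h := hA.det_eq_prod_eigenvalues
    rw [h, ← RCLike.ofReal_prod] at hdet
    exact hdet
  rw [negEigCount, dif_pos hA, Finset.card_le_one] at hcount
  have hne : ∀ i, hA.eigenvalues i ≠ 0 := fun i =>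
    Finset.prod_ne_zero_iff.mp hprod.ne' i (Finset.mem_univ i)
  rw [hA.posDef_iff_eigenvalues_pos]
  intro i
  by_contra hi
  have hi' : hA.eigenvalues i < 0 := lt_of_le_of_ne (not_lt.mp hi) (hne i)
  have hrest : 0 ≤ ∏ j ∈ Finset.univ.erase i, hA.eigenvalues j := by
    refine Finset.prod_nonneg fun j hj => ?_
    by_contra hj'
    exact Finset.ne_of_mem_erase hj
      (hcount j (by simpa using hj') i (by simpa using hi'))
  rw [← Finset.mul_prod_erase _ _ (Finset.mem_univ i)] at hprod
  exact absurd hprod (not_lt.mpr (mul_nonpos_of_nonpos_of_nonneg hi'.le hrest))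

open scoped ComplexOrder in
theorem diag_ne_zero_of_negEigCount_le_one {n : ℕ} {A : Matrix (Fin n) (Fin n) ℂ}
    (hA : A.IsHermitian) (hdet : 0 < A.det.re) (hcount : negEigCount A ≤ 1) (i : Fin n) :
    A i i ≠ 0 :=
  (posDef_of_negEigCount_le_one hA hdet hcount).diag_pos.ne'

theorem nevKernel_isHermitian (Q : ℂ → ℂ) {n : ℕ} (z : Fin n → ℂ) :
    (nevKernel Q z).IsHermitian := by
  refine Matrix.IsHermitian.ext fun i j => ?_
  simp only [nevKernel, Matrix.of_apply, Complex.star_def, map_div₀, map_sub, Complex.conj_conj]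
  rw [← neg_sub, ← neg_sub (z i), neg_div_neg_eq]

theorem nevKernel_eq_zero {Q : ℂ → ℂ} {c : ℂ} (hc : (starRingEnd ℂ) c = c) {n : ℕ}
    {z : Fin n → ℂ} (hz : ∀ i, Q (z i) = c) : nevKernel Q z = 0 := by
  ext i j
  simp [nevKernel, hz, hc]

theorem det_fin_four_of_zero_block {A : Matrix (Fin 4) (Fin 4) ℂ}
    (h00 : A 0 0 = 0) (h01 : A 0 1 = 0) (h10 : A 1 0 = 0) (h11 : A 1 1 = 0) :
    A.det = (A 0 2 * A 1 3 - A 0 3 * A 1 2) * (A 2 0 * A 3 1 - A 3 0 * A 2 1) := by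
  simp [Matrix.det_succ_row_zero, Fin.sum_univ_succ, Fin.succAbove, h00, h01, h10, h11]
  ring

theorem sub_conj_ne_zero {z w : ℂ} (hz : 0 < z.im) (hw : 0 < w.im) :
    z - (starRingEnd ℂ) w ≠ 0 := by
  intro h
  have := congrArg Complex.im h
  simp at this
  linarith

/-- A generalized Nevanlinna function with one negative square
attains each real value at most once in the open upper half-plane. -/
theorem statement5 (Q : ℂ → ℂ) (D : Set ℂ) (hQ : IsGenNevanlinnaOne Q D)
    (z₁ z₂ : ℂ) (hz₁ : z₁ ∈ D) (him₁ : 0 < z₁.im) (hz₂ : z₂ ∈ D) (him₂ : 0 < z₂.im)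
    (heq : Q z₁ = Q z₂) (hreal : (Q z₁).im = 0) :
    z₁ = z₂ := by
  by_contra hne
  have hc : (starRingEnd ℂ) (Q z₁) = Q z₁ := Complex.conj_eq_iff_im.mpr hreal
  obtain ⟨w₁, hw₁, hw₁im, hQw₁⟩ : ∃ w ∈ D, 0 < w.im ∧ Q w ≠ Q z₁ := by
    obtain ⟨n, z, hz, hcount⟩ := hQ.exists_one
    by_contra! hconst
    rw [nevKernel_eq_zero hc fun i => hconst (z i) (hz i).1 (hz i).2,
      negEigCount_zero] at hcount
    exact zero_ne_one hcount
  obtain ⟨w₂, ⟨hw₂, hw₂im, hQw₂⟩, hww⟩ :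
      ∃ w, (w ∈ D ∧ 0 < w.im ∧ Q w ≠ Q z₁) ∧ w ≠ w₁ := by
    have hDw := hQ.isOpen.mem_nhds hw₁
    have hnear : ∀ᶠ w in nhds w₁, w ∈ D ∧ 0 < w.im ∧ Q w ≠ Q z₁ :=
      (eventually_mem_set.mpr hDw).and
        ((Complex.continuous_im.continuousAt.eventually_const_lt hw₁im).and
          ((hQ.holo.differentiableAt hDw).continuousAt.eventually_ne hQw₁))
    exact ((hnear.filter_mono nhdsWithin_le_nhds).and
      (self_mem_nhdsWithin : {w₁}ᶜ ∈ nhdsWithin w₁ {w₁}ᶜ)).exists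
  set A := nevKernel Q ![z₁, z₂, w₁, w₂] with hA
  have hherm : A.IsHermitian := nevKernel_isHermitian Q _
  have h00 : A 0 0 = 0 := by simp [hA, nevKernel, hc]
  have h01 : A 0 1 = 0 := by simp [hA, nevKernel, ← heq, hc]
  have h10 : A 1 0 = 0 := by simp [hA, nevKernel, ← heq, hc]
  have h11 : A 1 1 = 0 := by simp [hA, nevKernel, ← heq, hc]
  have hminor : A 0 2 * A 1 3 - A 0 3 * A 1 2 ≠ 0 := by
    have e : A 0 2 * A 1 3 - A 0 3 * A 1 2 =
        (Q z₁ - (starRingEnd ℂ) (Q w₁)) * (Q z₁ - (starRingEnd ℂ) (Q w₂)) *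
          ((z₁ - z₂) * ((starRingEnd ℂ) w₂ - (starRingEnd ℂ) w₁)) /
        ((z₁ - (starRingEnd ℂ) w₁) * (z₂ - (starRingEnd ℂ) w₂) *
          ((z₁ - (starRingEnd ℂ) w₂) * (z₂ - (starRingEnd ℂ) w₁))) := by
      have d₁ := sub_conj_ne_zero him₁ hw₁im
      have d₂ := sub_conj_ne_zero him₂ hw₂im
      have d₃ := sub_conj_ne_zero him₁ hw₂im
      have d₄ := sub_conj_ne_zero him₂ hw₁im
      simp only [hA, nevKernel, Matrix.of_apply, Matrix.cons_val, ← heq]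
      field_simp
      ring
    have hvalue : ∀ w, Q w ≠ Q z₁ → Q z₁ - (starRingEnd ℂ) (Q w) ≠ 0 := fun w hw h =>
      hw ((starRingEnd ℂ).injective ((sub_eq_zero.mp h).symm.trans hc.symm))
    rw [e]
    exact div_ne_zero
      (mul_ne_zero (mul_ne_zero (hvalue w₁ hQw₁) (hvalue w₂ hQw₂))
        (mul_ne_zero (sub_ne_zero.mpr hne)
          (sub_ne_zero.mpr fun h => hww ((starRingEnd ℂ).injective h))))
      (mul_ne_zero
        (mul_ne_zero (sub_conj_ne_zero him₁ hw₁im) (sub_conj_ne_zero him₂ hw₂im))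
        (mul_ne_zero (sub_conj_ne_zero him₁ hw₂im) (sub_conj_ne_zero him₂ hw₁im)))
  have hdet : 0 < A.det.re := by
    have hstar : A 2 0 * A 3 1 - A 3 0 * A 2 1 =
        (starRingEnd ℂ) (A 0 2 * A 1 3 - A 0 3 * A 1 2) := by
      rw [← hherm.apply 2 0, ← hherm.apply 3 1, ← hherm.apply 3 0, ← hherm.apply 2 1]
      simp only [map_sub, map_mul, Complex.star_def]
    rw [det_fin_four_of_zero_block h00 h01 h10 h11, hstar, Complex.mul_conj, Complex.ofReal_re]
    exact Complex.normSq_pos.mpr hminor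
  have hcount : negEigCount A ≤ 1 := by
    refine hQ.le_one 4 _ fun i => ?_
    fin_cases i
    exacts [⟨hz₁, him₁⟩, ⟨hz₂, him₂⟩, ⟨hw₁, hw₁im⟩, ⟨hw₂, hw₂im⟩]
  exact diag_ne_zero_of_negEigCount_le_one hherm hdet hcount 0 h00
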